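/- In an arbitrage-free discrete market model with proportional transaction costs, for an American option with adapted ℝ²-valued payoff process (ξ,ζ), the supremum defining the buyer's price π^b(ξ,ζ) is attained, and π^b(ξ,ζ) = max over pure stopping times τ of the minimum over pairs (P,S) ∈ barP(τ) of E_P(ξ_τ + S_τ ζ_τ); in particular, there exist a pure stopping time τ̌ and a pair (P̌,Š) ∈ barP(τ̌) with π^b(ξ,ζ) = E_{P̌}(ξ_τ̌ + Š_τ̌ ζ_τ̌) = min_{(P,S) ∈ barP(τ̌)} E_P(ξ_τ̌ + S_τ̌ ζ_τ̌). -/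

import Mathlib

open MeasureTheory
open scoped Pointwise

noncomputable section

namespace RZ

variable {Ω : Type*} [Fintype Ω]

/-- `ω` and `ω'` lie in the same atom of the σ-field `m`. -/
def sameAtom (m : MeasurableSpace Ω) (ω ω' : Ω) : Prop :=
  ∀ A : Set Ω, MeasurableSet[m] A → (ω ∈ A ↔ ω' ∈ A)

/-- Elementary conditional expectation w.r.t. a σ-field on a finite space:
at `ω` it is the `P`-average of `f` over the atom of `ω`. -/
def condExp (m : MeasurableSpace Ω) (P : Ω → ℝ) (f : Ω → ℝ) (ω : Ω) : ℝ :=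
  (∑ ω' : Ω, Set.indicator {ω'' | sameAtom m ω ω''} (fun ω'' => P ω'' * f ω'') ω') /
  (∑ ω' : Ω, Set.indicator {ω'' | sameAtom m ω ω''} P ω')

/-- Expectation under `P`. -/
def expect (P : Ω → ℝ) (f : Ω → ℝ) : ℝ := ∑ ω : Ω, P ω * f ω

/-- Discrete market model with proportional transaction costs. -/
structure Market (Ω : Type*) [Fintype Ω] where
  T : ℕ
  T_pos : 0 < T
  F : ℕ → MeasurableSpace Ω
  F_mono : ∀ ⦃s t : ℕ⦄, s ≤ t → F s ≤ F t
  F_zero : F 0 = ⊥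
  F_top : F T = ⊤
  Q : Ω → ℝ
  Q_pos : ∀ ω, 0 < Q ω
  Q_sum : ∑ ω, Q ω = 1
  Sb : ℕ → Ω → ℝ
  Sa : ℕ → Ω → ℝ
  Sb_pos : ∀ t ω, t ≤ T → 0 < Sb t ω
  Sb_le_Sa : ∀ t ω, t ≤ T → Sb t ω ≤ Sa t ω
  Sb_adapted : ∀ t, t ≤ T → Measurable[F t] (Sb t)
  Sa_adapted : ∀ t, t ≤ T → Measurable[F t] (Sa t)

variable (M : Market Ω)

/-- Liquidation value θ_t(γ, δ) in scenario ω, for a cash position γ and stock position δ. -/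
def liq (t : ℕ) (ω : Ω) (γ δ : ℝ) : ℝ :=
  γ + M.Sb t ω * max δ 0 - M.Sa t ω * max (-δ) 0

/-- An adapted (real-valued) process. -/
def IsAdapted (X : ℕ → Ω → ℝ) : Prop := ∀ t, t ≤ M.T → Measurable[M.F t] (X t)

/-- An adapted ℝ²-valued payoff process. -/
def AdaptedPair (ξ ζ : ℕ → Ω → ℝ) : Prop := IsAdapted M ξ ∧ IsAdapted M ζ

/-- Self-financing strategy. -/
def SelfFinancing (α β : ℕ → Ω → ℝ) : Prop :=
  Measurable[M.F 0] (α 0) ∧ Measurable[M.F 0] (β 0) ∧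
  (∀ t, t < M.T → Measurable[M.F t] (α (t + 1)) ∧ Measurable[M.F t] (β (t + 1))) ∧
  (∀ t, t < M.T → ∀ ω, 0 ≤ liq M t ω (α t ω - α (t + 1) ω) (β t ω - β (t + 1) ω))

/-- Pure stopping time with values in {0,...,T}. -/
def IsStop (τ : Ω → ℕ) : Prop :=
  (∀ ω, τ ω ≤ M.T) ∧ ∀ t : ℕ, MeasurableSet[M.F t] {ω | τ ω = t}

/-- Seller superhedging strategy. -/
def SellerHedge (ξ ζ α β : ℕ → Ω → ℝ) : Prop :=
  SelfFinancing M α β ∧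
  ∀ τ, IsStop M τ → ∀ ω,
    0 ≤ liq M (τ ω) ω (α (τ ω) ω - ξ (τ ω) ω) (β (τ ω) ω - ζ (τ ω) ω)

/-- Buyer superhedging strategy. -/
def BuyerHedge (ξ ζ α β : ℕ → Ω → ℝ) : Prop :=
  SelfFinancing M α β ∧
  ∃ τ, IsStop M τ ∧ ∀ ω,
    0 ≤ liq M (τ ω) ω (α (τ ω) ω + ξ (τ ω) ω) (β (τ ω) ω + ζ (τ ω) ω)

/-- Seller's (ask) price: infimum of the initial costs of seller superhedging strategies. -/
def askPrice (ξ ζ : ℕ → Ω → ℝ) : ℝ :=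
  sInf {x | ∃ α β, SellerHedge M ξ ζ α β ∧ ∀ ω, x = -liq M 0 ω (-α 0 ω) (-β 0 ω)}

/-- Buyer's (bid) price: supremum of the amounts raised by buyer superhedging strategies. -/
def bidPrice (ξ ζ : ℕ → Ω → ℝ) : ℝ :=
  sSup {x | ∃ α β, BuyerHedge M ξ ζ α β ∧ ∀ ω, x = liq M 0 ω (-α 0 ω) (-β 0 ω)}

/-- Mixed stopping time. -/
def IsMixedStop (χ : ℕ → Ω → ℝ) : Prop :=
  (∀ t, t ≤ M.T → Measurable[M.F t] (χ t)) ∧ (∀ t ω, 0 ≤ χ t ω) ∧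
  ∀ ω, ∑ t ∈ Finset.range (M.T + 1), χ t ω = 1

/-- χ*_t = Σ_{s=t}^T χ_s  (so χ*_{T+1} = 0). -/
def chiStar (χ : ℕ → Ω → ℝ) (t : ℕ) (ω : Ω) : ℝ := ∑ s ∈ Finset.Icc t M.T, χ s ω

/-- Z^{χ*}_t = Σ_{s=t}^T χ_s Z_s  (so Z^{χ*}_{T+1} = 0). -/
def starVal (χ Z : ℕ → Ω → ℝ) (t : ℕ) (ω : Ω) : ℝ :=
  ∑ s ∈ Finset.Icc t M.T, χ s ω * Z s ω

/-- Z_χ = Σ_{t=0}^T χ_t Z_t. -/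
def mixVal (χ Z : ℕ → Ω → ℝ) (ω : Ω) : ℝ :=
  ∑ t ∈ Finset.range (M.T + 1), χ t ω * Z t ω

/-- Membership in the family barP(χ). -/
def memBarP (χ : ℕ → Ω → ℝ) (P : Ω → ℝ) (S : ℕ → Ω → ℝ) : Prop :=
  (∀ ω, 0 ≤ P ω) ∧ (∑ ω, P ω) = 1 ∧ IsAdapted M S ∧
  (∀ t ω, t ≤ M.T → M.Sb t ω ≤ S t ω ∧ S t ω ≤ M.Sa t ω) ∧
  (∀ t, t ≤ M.T → ∀ ω, 0 < P ω →
    chiStar M χ (t + 1) ω * M.Sb t ω ≤ condExp (M.F t) P (starVal M χ S (t + 1)) ω ∧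
    condExp (M.F t) P (starVal M χ S (t + 1)) ω ≤ chiStar M χ (t + 1) ω * M.Sa t ω)

/-- Membership in the family P(χ): barP(χ) with P equivalent to Q. -/
def memP (χ : ℕ → Ω → ℝ) (P : Ω → ℝ) (S : ℕ → Ω → ℝ) : Prop :=
  memBarP M χ P S ∧ ∀ ω, 0 < P ω

/-- The mixed stopping time χ^τ associated with a pure stopping time τ. -/
def pureChi (τ : Ω → ℕ) : ℕ → Ω → ℝ := fun t ω => if τ ω = t then 1 else 0

/-- Arbitrage-free: there is an equivalent probability measure and a martingale
between the bid and ask prices. -/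
def ArbitrageFree : Prop :=
  ∃ (P : Ω → ℝ) (S : ℕ → Ω → ℝ),
    (∀ ω, 0 < P ω) ∧ (∑ ω, P ω) = 1 ∧ IsAdapted M S ∧
    (∀ t ω, t ≤ M.T → M.Sb t ω ≤ S t ω ∧ S t ω ≤ M.Sa t ω) ∧
    (∀ t, t < M.T → ∀ ω, 0 < P ω → condExp (M.F t) P (S (t + 1)) ω = S t ω)

/-- Epigraph of a function ℝ → ℝ, as a subset of ℝ² (first coordinate dominates). -/
def epi (f : ℝ → ℝ) : Set (ℝ × ℝ) := {p | f p.2 ≤ p.1}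

/-- The function h_{[b,a]}(y) = a y⁻ − b y⁺. -/
def hfun (b a : ℝ) (y : ℝ) : ℝ := a * max (-y) 0 - b * max y 0

/-- Seller's payoff function u_t(y) = ξ_t + (y − ζ_t)⁻ S^a_t − (y − ζ_t)⁺ S^b_t. -/
def uSell (ξ ζ : ℕ → Ω → ℝ) (t : ℕ) (ω : Ω) (y : ℝ) : ℝ :=
  ξ t ω + M.Sa t ω * max (ζ t ω - y) 0 - M.Sb t ω * max (y - ζ t ω) 0

/-- Buyer's payoff function u_t(y) = −ξ_t + (y + ζ_t)⁻ S^a_t − (y + ζ_t)⁺ S^b_t. -/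
def uBuy (ξ ζ : ℕ → Ω → ℝ) (t : ℕ) (ω : Ω) (y : ℝ) : ℝ :=
  -ξ t ω + M.Sa t ω * max (-(y + ζ t ω)) 0 - M.Sb t ω * max (y + ζ t ω) 0

/-- The seller's pricing recursion: one function per atom,
`z_T = u_T` and `epi z_{t-1} = epi u_{t-1} ∩ (epi h + ⋂_{succ} epi z_t)`. -/
def SellerRec (ξ ζ : ℕ → Ω → ℝ) (z : ℕ → Ω → ℝ → ℝ) : Prop :=
  (∀ t ω ω', t ≤ M.T → sameAtom (M.F t) ω ω' → z t ω = z t ω') ∧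
  (∀ ω, z M.T ω = uSell M ξ ζ M.T ω) ∧
  (∀ t ω, t < M.T →
    epi (z t ω) = epi (uSell M ξ ζ t ω) ∩
      (epi (hfun (M.Sb t ω) (M.Sa t ω)) +
        ⋂ ω' ∈ {ω'' | sameAtom (M.F t) ω ω''}, epi (z (t + 1) ω')))

/-- The buyer's pricing recursion: one function per atom,
`z_T = u_T` and `epi z_{t-1} = epi u_{t-1} ∪ (epi h + ⋂_{succ} epi z_t)`. -/
def BuyerRec (ξ ζ : ℕ → Ω → ℝ) (z : ℕ → Ω → ℝ → ℝ) : Prop :=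
  (∀ t ω ω', t ≤ M.T → sameAtom (M.F t) ω ω' → z t ω = z t ω') ∧
  (∀ ω, z M.T ω = uBuy M ξ ζ M.T ω) ∧
  (∀ t ω, t < M.T →
    epi (z t ω) = epi (uBuy M ξ ζ t ω) ∪
      (epi (hfun (M.Sb t ω) (M.Sa t ω)) +
        ⋂ ω' ∈ {ω'' | sameAtom (M.F t) ω ω''}, epi (z (t + 1) ω')))

section Farkas

/-- **Farkas' lemma** for finitely many linear functionals on an arbitrary real vector space. -/
theorem farkas {ι W : Type*} [AddCommGroup W] [Module ℝ W] (s : Finset ι) :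
    ∀ (A : ι → W →ₗ[ℝ] ℝ) (b : W →ₗ[ℝ] ℝ),
      (∀ x, (∀ i ∈ s, 0 ≤ A i x) → 0 ≤ b x) →
      ∃ u : ι → ℝ, (∀ i, 0 ≤ u i) ∧ ∀ x, b x = ∑ i ∈ s, u i * A i x := by
  classical
  induction s using Finset.induction_on with
  | empty =>
    intro A b h
    refine ⟨fun _ => 0, fun _ => le_rfl, fun x => ?_⟩
    have h1 := h x (by simp)
    have h2 := h (-x) (by simp)
    rw [map_neg] at h2
    simp only [Finset.sum_empty]
    linarith
  | insert j s hj ih =>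
    intro A b h
    by_cases hb : ∀ x, (∀ i ∈ s, 0 ≤ A i x) → 0 ≤ b x
    · obtain ⟨u, hu, hub⟩ := ih A b hb
      refine ⟨fun i => if i = j then 0 else u i, fun i => ?_, fun x => ?_⟩
      · dsimp only
        split_ifs
        exacts [le_rfl, hu i]
      · rw [Finset.sum_insert hj, hub x]
        simp only [if_true, zero_mul, zero_add]
        refine Finset.sum_congr rfl fun i hi => ?_
        rw [if_neg (ne_of_mem_of_not_mem hi hj)]
    · push Not at hb
      obtain ⟨z, hz, hbz⟩ := hb
      have hjz : A j z < 0 := by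
        by_contra hc
        push Not at hc
        refine absurd (h z fun i hi => ?_) (not_le.mpr hbz)
        rcases Finset.mem_insert.mp hi with rfl | hi
        exacts [hc, hz i hi]
      set c : ℝ := (-A j z)⁻¹ with hc
      have hcpos : 0 < c := inv_pos.mpr (by linarith)
      have hcz : c * A j z = -1 := by
        rw [hc, inv_neg, neg_mul, inv_mul_cancel₀ hjz.ne]
      obtain ⟨u, hu, hub⟩ := ih (fun i => A i + (c * A i z) • A j) (b + (c * b z) • A j) (by
        intro x hx
        have := h (x + (c * A j x) • z) (by
          intro i hi
          rcases Finset.mem_insert.mp hi with rfl | hi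
          · simp only [map_add, map_smul, smul_eq_mul]
            apply le_of_eq
            linear_combination (-(A i x)) * hcz
          · have := hx i hi
            simp only [LinearMap.add_apply, LinearMap.smul_apply, smul_eq_mul] at this
            simp only [map_add, map_smul, smul_eq_mul]
            linarith)
        simp only [map_add, map_smul, smul_eq_mul] at this
        simp only [LinearMap.add_apply, LinearMap.smul_apply, smul_eq_mul]
        linarith)
      have hk : 0 ≤ c * (∑ i ∈ s, u i * A i z - b z) :=
        mul_nonneg hcpos.le (by
          have : 0 ≤ ∑ i ∈ s, u i * A i z :=
            Finset.sum_nonneg fun i hi => mul_nonneg (hu i) (hz i hi)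
          linarith)
      refine ⟨fun i => if i = j then c * (∑ i ∈ s, u i * A i z - b z) else u i,
        fun i => ?_, fun x => ?_⟩
      · dsimp only
        split_ifs
        exacts [hk, hu i]
      · have hx := hub x
        simp only [LinearMap.add_apply, LinearMap.smul_apply, smul_eq_mul] at hx
        have e1 : ∑ i ∈ s, u i * (A i x + c * A i z * A j x) =
            ∑ i ∈ s, u i * A i x + c * A j x * ∑ i ∈ s, u i * A i z := by
          rw [Finset.mul_sum, ← Finset.sum_add_distrib]
          exact Finset.sum_congr rfl fun i _ => by ring
        have e2 : ∑ i ∈ s, (if i = j then c * (∑ i ∈ s, u i * A i z - b z) else u i) * A i x =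
            ∑ i ∈ s, u i * A i x :=
          Finset.sum_congr rfl fun i hi => by rw [if_neg (ne_of_mem_of_not_mem hi hj)]
        rw [Finset.sum_insert hj, e2]
        simp only [if_true]
        rw [e1] at hx
        linear_combination hx

/-- Farkas' lemma with one distinguished constraint. -/
theorem farkas_with_extra {ι W : Type*} [Fintype ι] [AddCommGroup W] [Module ℝ W]
    (A : ι → W →ₗ[ℝ] ℝ) (e b : W →ₗ[ℝ] ℝ)
    (h : ∀ x, (∀ i, 0 ≤ A i x) → 0 ≤ e x → 0 ≤ b x) :
    ∃ (u : ι → ℝ) (k : ℝ), (∀ i, 0 ≤ u i) ∧ 0 ≤ k ∧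
      ∀ x, b x = k * e x + ∑ i, u i * A i x := by
  obtain ⟨u, hu, hub⟩ := farkas (Finset.univ : Finset (Option ι)) (fun o => o.elim e A) b
    (fun x hx => h x (fun i => hx (some i) (Finset.mem_univ _)) (hx none (Finset.mem_univ _)))
  refine ⟨fun i => u (some i), u none, fun i => hu _, hu _, fun x => ?_⟩
  rw [hub x, Fintype.sum_option]
  rfl

end Farkas

section Atoms

set_option linter.unusedSectionVars false

lemma sameAtom.refl (m : MeasurableSpace Ω) (ω : Ω) : sameAtom m ω ω := fun _ _ => Iff.rfl

lemma sameAtom.symm {m : MeasurableSpace Ω} {ω ω' : Ω} (h : sameAtom m ω ω') :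
    sameAtom m ω' ω := fun A hA => (h A hA).symm

lemma sameAtom.trans {m : MeasurableSpace Ω} {ω ω' ω'' : Ω} (h : sameAtom m ω ω')
    (h' : sameAtom m ω' ω'') : sameAtom m ω ω'' := fun A hA => (h A hA).trans (h' A hA)

lemma sameAtom.mono {m m' : MeasurableSpace Ω} (hm : m ≤ m') {ω ω' : Ω}
    (h : sameAtom m' ω ω') : sameAtom m ω ω' := fun A hA => h A (hm A hA)

lemma sameAtom_bot (ω ω' : Ω) : sameAtom (⊥ : MeasurableSpace Ω) ω ω' := by
  intro A hA
  rcases MeasurableSpace.measurableSet_bot_iff.mp hA with rfl | rfl <;> simp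

/-- `f` is constant on the atoms of `m`. -/
def AtomConst (m : MeasurableSpace Ω) (f : Ω → ℝ) : Prop :=
  ∀ ω ω', sameAtom m ω ω' → f ω = f ω'

lemma measurableSet_of_sameAtom {m : MeasurableSpace Ω} {B : Set Ω}
    (h : ∀ ω ω', sameAtom m ω ω' → ω ∈ B → ω' ∈ B) : MeasurableSet[m] B := by
  have hB : B = ⋃ ω ∈ B, measurableAtom ω := by
    ext ω
    simp only [Set.mem_iUnion, exists_prop]
    constructor
    · exact fun hω => ⟨ω, hω, mem_measurableAtom_self ω⟩
    · rintro ⟨ω', hω', hω⟩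
      refine h ω' ω (fun A hA => ⟨fun hA' => ?_, fun hA' => ?_⟩) hω'
      · exact measurableAtom_subset hA hA' hω
      · by_contra hc
        exact measurableAtom_subset hA.compl hc hω hA'
  rw [hB]
  exact MeasurableSet.biUnion (Set.to_countable B)
    fun ω _ => MeasurableSet.measurableAtom_of_countable ω

lemma measurable_iff_atomConst {m : MeasurableSpace Ω} {f : Ω → ℝ} :
    Measurable[m] f ↔ AtomConst m f := by
  constructor
  · intro hf ω ω' h
    exact ((h (f ⁻¹' {f ω}) (hf (measurableSet_singleton _))).mp rfl).symm
  · intro hf B _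
    refine measurableSet_of_sameAtom fun ω ω' h hω => ?_
    rw [Set.mem_preimage, ← hf ω ω' h]
    exact hω

lemma AtomConst.sub {m : MeasurableSpace Ω} {f g : Ω → ℝ} (hf : AtomConst m f)
    (hg : AtomConst m g) : AtomConst m (fun ω => f ω - g ω) := fun ω ω' h => by
  simp only [hf ω ω' h, hg ω ω' h]

lemma AtomConst.mono {m m' : MeasurableSpace Ω} (hm : m ≤ m') {f : Ω → ℝ}
    (hf : AtomConst m f) : AtomConst m' f := fun ω ω' h => hf ω ω' (h.mono hm)

/-- The equivalence relation of lying in the same atom. -/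
def atomSetoid (m : MeasurableSpace Ω) : Setoid Ω where
  r := sameAtom m
  iseqv := ⟨sameAtom.refl m, sameAtom.symm, sameAtom.trans⟩

/-- A chosen representative of the atom of `ω`. -/
def rep (m : MeasurableSpace Ω) (ω : Ω) : Ω := (Quotient.mk (atomSetoid m) ω).out

lemma sameAtom_rep (m : MeasurableSpace Ω) (ω : Ω) : sameAtom m (rep m ω) ω :=
  Quotient.exact (s := atomSetoid m) (Quotient.out_eq _)

lemma rep_eq_of_sameAtom {m : MeasurableSpace Ω} {ω ω' : Ω} (h : sameAtom m ω ω') :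
    rep m ω = rep m ω' := by
  unfold rep
  rw [Quotient.sound (s := atomSetoid m) h]

open Classical in
lemma condExp_eq (m : MeasurableSpace Ω) (P f : Ω → ℝ) (ω : Ω) :
    condExp m P f ω = (∑ ω', if sameAtom m ω ω' then P ω' * f ω' else 0) /
      ∑ ω', if sameAtom m ω ω' then P ω' else 0 := by
  unfold condExp
  simp only [Set.indicator_apply, Set.mem_ofPred_eq]

open Classical in
lemma le_atomProb {m : MeasurableSpace Ω} {P : Ω → ℝ} (hP : ∀ ω, 0 ≤ P ω) (ω : Ω) :
    P ω ≤ ∑ ω', if sameAtom m ω ω' then P ω' else 0 := by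
  have := Finset.single_le_sum (f := fun ω' => if sameAtom m ω ω' then P ω' else 0)
    (fun i _ => by split_ifs; exacts [hP i, le_rfl]) (Finset.mem_univ ω)
  simpa [sameAtom.refl m ω] using this

/-- Pulling an `m`-measurable factor through the conditional expectation. -/
lemma sum_mul_condExp {m : MeasurableSpace Ω} {P : Ω → ℝ} (hP : ∀ ω, 0 ≤ P ω)
    {X : Ω → ℝ} (hX : AtomConst m X) (f : Ω → ℝ) :
    ∑ ω, P ω * (X ω * condExp m P f ω) = ∑ ω, P ω * (X ω * f ω) := by
  classical
  set Z : Ω → ℝ := fun ω => ∑ ω', if sameAtom m ω ω' then P ω' else 0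
  have hZc : ∀ ω ω', sameAtom m ω ω' → Z ω = Z ω' := fun ω ω' h =>
    Finset.sum_congr rfl fun ω'' _ => by
      have : sameAtom m ω ω'' ↔ sameAtom m ω' ω'' := ⟨h.symm.trans, h.trans⟩
      simp only [this]
  calc ∑ ω, P ω * (X ω * condExp m P f ω)
      = ∑ ω, ∑ ω', (if sameAtom m ω' ω then P ω else 0) * (P ω' * X ω' * f ω' / Z ω') := by
        refine Finset.sum_congr rfl fun ω _ => ?_
        rw [condExp_eq, Finset.sum_div, Finset.mul_sum, Finset.mul_sum]
        refine Finset.sum_congr rfl fun ω' _ => ?_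
        by_cases h : sameAtom m ω ω'
        · rw [if_pos h, if_pos h.symm, hX ω ω' h]
          change P ω * (X ω' * (P ω' * f ω' / Z ω)) = _
          rw [hZc ω ω' h]
          ring
        · rw [if_neg h, if_neg (fun h' => h h'.symm)]
          ring
    _ = ∑ ω', Z ω' * (P ω' * X ω' * f ω' / Z ω') := by
        rw [Finset.sum_comm]
        exact Finset.sum_congr rfl fun ω' _ => by rw [← Finset.sum_mul]
    _ = ∑ ω, P ω * (X ω * f ω) := by
        refine Finset.sum_congr rfl fun ω _ => ?_
        rcases (hP ω).eq_or_lt with h | h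
        · rw [← h]; ring
        · have : Z ω ≠ 0 := (h.trans_le (le_atomProb hP ω)).ne'
          field_simp

end Atoms

section Market

variable {M}

lemma liq_le {t : ℕ} {ω : Ω} {c : ℝ} (hb : M.Sb t ω ≤ c) (ha : c ≤ M.Sa t ω) (γ δ : ℝ) :
    liq M t ω γ δ ≤ γ + c * δ := by
  unfold liq
  rcases le_total 0 δ with h | h
  · rw [max_eq_left h, max_eq_right (by linarith)]
    nlinarith
  · rw [max_eq_right h, max_eq_left (by linarith)]
    nlinarith

lemma liq_nonneg {t : ℕ} {ω : Ω} {γ δ : ℝ} (hb : 0 ≤ γ + M.Sb t ω * δ)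
    (ha : 0 ≤ γ + M.Sa t ω * δ) : 0 ≤ liq M t ω γ δ := by
  unfold liq
  rcases le_total 0 δ with h | h
  · rw [max_eq_left h, max_eq_right (by linarith)]
    linarith
  · rw [max_eq_right h, max_eq_left (by linarith)]
    linarith

lemma IsStop.sameAtom_lt {τ : Ω → ℕ} (hτ : IsStop M τ) {t : ℕ} {ω ω' : Ω}
    (h : sameAtom (M.F t) ω ω') : t < τ ω ↔ t < τ ω' := by
  have key : ∀ {ω ω'}, sameAtom (M.F t) ω ω' → τ ω ≤ t → τ ω' ≤ t := fun {ω ω'} h hle => by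
    have : τ ω' = τ ω := (h.mono (M.F_mono hle) _ (hτ.2 (τ ω))).mp rfl
    omega
  have h1 := key h
  have h2 := key h.symm
  omega

lemma IsStop.sameAtom_eq {τ : Ω → ℕ} (hτ : IsStop M τ) {t : ℕ} {ω ω' : Ω}
    (h : sameAtom (M.F t) ω ω') (ht : τ ω = t) : τ ω' = t := (h _ (hτ.2 t)).mp ht

lemma chiStar_pureChi {τ : Ω → ℕ} (hτ : IsStop M τ) (t : ℕ) (ω : Ω) :
    chiStar M (pureChi τ) (t + 1) ω = if t < τ ω then 1 else 0 := by
  have := hτ.1 ω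
  simp only [chiStar, pureChi, Finset.sum_ite_eq, Finset.mem_Icc]
  exact if_congr (by omega) rfl rfl

lemma starVal_pureChi {τ : Ω → ℕ} (hτ : IsStop M τ) (Z : ℕ → Ω → ℝ) (t : ℕ) (ω : Ω) :
    starVal M (pureChi τ) Z (t + 1) ω = if t < τ ω then Z (τ ω) ω else 0 := by
  have := hτ.1 ω
  simp only [starVal, pureChi, ite_mul, one_mul, zero_mul, Finset.sum_ite_eq, Finset.mem_Icc]
  exact if_congr (by omega) rfl rfl

/-- The conditional expectation in the definition of `memBarP`, for a pure stopping time. -/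
def dualPrice (M : Market Ω) (τ : Ω → ℕ) (P : Ω → ℝ) (S : ℕ → Ω → ℝ) (t : ℕ) : Ω → ℝ :=
  condExp (M.F t) P (starVal M (pureChi τ) S (t + 1))

lemma dualPrice_mem {τ : Ω → ℕ} (hτ : IsStop M τ) {P : Ω → ℝ} {S : ℕ → Ω → ℝ}
    (h : memBarP M (pureChi τ) P S) {t : ℕ} (ht : t ≤ M.T) {ω : Ω} (hω : 0 < P ω) :
    (t < τ ω → M.Sb t ω ≤ dualPrice M τ P S t ω ∧ dualPrice M τ P S t ω ≤ M.Sa t ω) ∧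
      (¬ t < τ ω → dualPrice M τ P S t ω = 0) := by
  have := h.2.2.2.2 t ht ω hω
  rw [chiStar_pureChi hτ] at this
  refine ⟨fun hlt => ?_, fun hlt => ?_⟩
  · rw [if_pos hlt, one_mul, one_mul] at this
    exact this
  · rw [if_neg hlt, zero_mul, zero_mul] at this
    exact le_antisymm this.2 this.1

lemma sum_mul_dualPrice {τ : Ω → ℕ} (hτ : IsStop M τ) {P : Ω → ℝ} (hP : ∀ ω, 0 ≤ P ω)
    (S : ℕ → Ω → ℝ) (t : ℕ) {X : Ω → ℝ} (hX : AtomConst (M.F t) X) :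
    ∑ ω, P ω * (X ω * dualPrice M τ P S t ω) =
      ∑ ω, P ω * (X ω * if t < τ ω then S (τ ω) ω else 0) := by
  unfold dualPrice
  rw [sum_mul_condExp hP hX]
  simp only [starVal_pureChi hτ]

lemma SelfFinancing.atomConst {α β : ℕ → Ω → ℝ} (h : SelfFinancing M α β) {t : ℕ}
    (ht : t < M.T) : AtomConst (M.F t) (α t) ∧ AtomConst (M.F t) (β t) ∧
      AtomConst (M.F t) (α (t + 1)) ∧ AtomConst (M.F t) (β (t + 1)) := by
  refine ⟨?_, ?_, measurable_iff_atomConst.mp (h.2.2.1 t ht).1,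
    measurable_iff_atomConst.mp (h.2.2.1 t ht).2⟩
  · cases t with
    | zero => exact measurable_iff_atomConst.mp h.1
    | succ n =>
      exact (measurable_iff_atomConst.mp (h.2.2.1 n (by omega)).1).mono (M.F_mono (Nat.le_succ n))
  · cases t with
    | zero => exact measurable_iff_atomConst.mp h.2.1
    | succ n =>
      exact (measurable_iff_atomConst.mp (h.2.2.1 n (by omega)).2).mono (M.F_mono (Nat.le_succ n))

/-- The stopped wealth of a self-financing strategy, priced at `S_τ`, is a supermartingale in
expectation. -/
lemma SelfFinancing.sum_stopped_le {τ : Ω → ℕ} (hτ : IsStop M τ) {P : Ω → ℝ}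
    {S : ℕ → Ω → ℝ} (hPS : memBarP M (pureChi τ) P S) {α β : ℕ → Ω → ℝ}
    (h : SelfFinancing M α β) {n : ℕ} (hn : n ≤ M.T) :
    ∑ ω, P ω * (α (min (τ ω) n) ω + S (τ ω) ω * β (min (τ ω) n) ω) ≤
      ∑ ω, P ω * (α 0 ω + S (τ ω) ω * β 0 ω) := by
  induction n with
  | zero => simp
  | succ n ih =>
    refine le_trans ?_ (ih (by omega))
    have hn' : n < M.T := by omega
    obtain ⟨-, hβ, -, hβ'⟩ := h.atomConst hn'
    have hsum := sum_mul_dualPrice hτ hPS.1 S n (hβ'.sub hβ)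
    have hle : ∑ ω, P ω * ((if n < τ ω then α (n + 1) ω - α n ω else 0) +
        (β (n + 1) ω - β n ω) * dualPrice M τ P S n ω) ≤ 0 := by
      refine Finset.sum_nonpos fun ω _ => ?_
      rcases (hPS.1 ω).eq_or_lt with h0 | h0
      · rw [← h0, zero_mul]
      · obtain ⟨h1, h2⟩ := dualPrice_mem hτ hPS hn'.le h0
        refine mul_nonpos_of_nonneg_of_nonpos h0.le ?_
        split_ifs with hlt
        · have := (h.2.2.2 n hn' ω).trans (liq_le (h1 hlt).1 (h1 hlt).2 _ _)
          linarith
        · rw [h2 hlt]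
          simp
    have heq : ∑ ω, P ω * (α (min (τ ω) (n + 1)) ω + S (τ ω) ω * β (min (τ ω) (n + 1)) ω) =
        ∑ ω, P ω * (α (min (τ ω) n) ω + S (τ ω) ω * β (min (τ ω) n) ω) +
        ∑ ω, P ω * ((if n < τ ω then α (n + 1) ω - α n ω else 0) +
          (β (n + 1) ω - β n ω) * dualPrice M τ P S n ω) := by
      simp only [mul_add, Finset.sum_add_distrib] at hsum ⊢
      rw [hsum]
      simp only [← Finset.sum_add_distrib]
      refine Finset.sum_congr rfl fun ω _ => ?_
      split_ifs with hlt
      · rw [min_eq_right hlt, min_eq_right hlt.le]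
        ring
      · rw [min_eq_left (by omega), min_eq_left (by omega)]
        ring
    linarith

/-- Weak duality: no hedge exercised at `τ` raises more than any dual value. -/
theorem liq_le_expect {τ : Ω → ℕ} (hτ : IsStop M τ) {P : Ω → ℝ}
    {S : ℕ → Ω → ℝ} (hPS : memBarP M (pureChi τ) P S) {ξ ζ α β : ℕ → Ω → ℝ}
    (h : SelfFinancing M α β)
    (hex : ∀ ω, 0 ≤ liq M (τ ω) ω (α (τ ω) ω + ξ (τ ω) ω) (β (τ ω) ω + ζ (τ ω) ω))
    (ω₀ : Ω) :
    liq M 0 ω₀ (-α 0 ω₀) (-β 0 ω₀) ≤ expect P (fun ω => ξ (τ ω) ω + S (τ ω) ω * ζ (τ ω) ω) := by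
  obtain ⟨hP, hP1, -, hS, -⟩ := id hPS
  have h1 := h.sum_stopped_le hτ hPS (le_refl M.T)
  have h2 : 0 ≤ ∑ ω, P ω * (α (min (τ ω) M.T) ω + S (τ ω) ω * β (min (τ ω) M.T) ω) +
      expect P (fun ω => ξ (τ ω) ω + S (τ ω) ω * ζ (τ ω) ω) := by
    unfold expect
    rw [← Finset.sum_add_distrib]
    refine Finset.sum_nonneg fun ω _ => ?_
    rw [min_eq_left (hτ.1 ω), ← mul_add]
    refine mul_nonneg (hP ω) ?_
    have := (hex ω).trans (liq_le (hS _ ω (hτ.1 ω)).1 (hS _ ω (hτ.1 ω)).2 _ _)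
    linarith
  obtain ⟨hα, hβ, -, -⟩ := h.atomConst M.T_pos
  have hconst : ∀ {f : Ω → ℝ}, AtomConst (M.F 0) f → ∀ ω, f ω = f ω₀ := fun hf ω =>
    hf _ _ (by rw [M.F_zero]; exact sameAtom_bot _ _)
  have hb := hconst (measurable_iff_atomConst.mp (M.Sb_adapted 0 (Nat.zero_le _)))
  have ha := hconst (measurable_iff_atomConst.mp (M.Sa_adapted 0 (Nat.zero_le _)))
  have h3 : ∑ ω, P ω * (α 0 ω + S (τ ω) ω * β 0 ω) ≤
      ∑ ω, P ω * (-liq M 0 ω₀ (-α 0 ω₀) (-β 0 ω₀)) := by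
    have e : ∑ ω, P ω * (α 0 ω + S (τ ω) ω * β 0 ω) =
        ∑ ω, P ω * (α 0 ω + (if 0 < τ ω then 0 else S (τ ω) ω * β 0 ω)
          + β 0 ω * dualPrice M τ P S 0 ω) := by
      have hsum := sum_mul_dualPrice hτ hP S 0 hβ
      simp only [mul_add, Finset.sum_add_distrib] at hsum ⊢
      rw [hsum]
      simp only [← Finset.sum_add_distrib]
      refine Finset.sum_congr rfl fun ω _ => ?_
      split_ifs <;> ring
    rw [e]
    refine Finset.sum_le_sum fun ω _ => ?_
    rcases (hP ω).eq_or_lt with h0 | h0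
    · rw [← h0, zero_mul, zero_mul]
    · obtain ⟨h1, h2⟩ := dualPrice_mem hτ hPS (Nat.zero_le _) h0
      refine mul_le_mul_of_nonneg_left ?_ h0.le
      rw [hconst hα ω, hconst hβ ω]
      rw [hb, ha] at h1
      split_ifs with hlt
      · have := liq_le (M := M) (t := 0) (h1 hlt).1 (h1 hlt).2 (-α 0 ω₀) (-β 0 ω₀)
        linarith
      · rw [h2 hlt]
        have h0' : τ ω = 0 := by omega
        have hS0 := hS 0 ω (Nat.zero_le _)
        rw [hb, ha] at hS0
        have := liq_le (M := M) (t := 0) hS0.1 hS0.2 (-α 0 ω₀) (-β 0 ω₀)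
        rw [h0']
        linarith
  rw [← Finset.sum_mul, hP1] at h3
  linarith

/-- In an arbitrage-free model the dual set is nonempty, by optional stopping. -/
theorem exists_memBarP (hNA : ArbitrageFree M) {τ : Ω → ℕ} (hτ : IsStop M τ) :
    ∃ P S, memBarP M (pureChi τ) P S := by
  classical
  obtain ⟨P, S, hP, hP1, hS, hbd, hmart⟩ := hNA
  have hP0 : ∀ ω, 0 ≤ P ω := fun ω => (hP ω).le
  refine ⟨P, S, hP0, hP1, hS, hbd, fun t ht ω hω => ?_⟩
  have hconst_stopped : ∀ n, t ≤ n → n ≤ M.T →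
      ∑ ω', (if sameAtom (M.F t) ω ω' then
        P ω' * (if t < τ ω' then S (min (τ ω') n) ω' else 0) else 0) =
      ∑ ω', (if sameAtom (M.F t) ω ω' then P ω' * (if t < τ ω' then S t ω' else 0) else 0) := by
    intro n hn
    induction n, hn using Nat.le_induction with
    | base =>
      intro _
      refine Finset.sum_congr rfl fun ω' _ => ?_
      split_ifs with h1 h2
      · rw [min_eq_right h2.le]
      · rfl
      · rfl
    | succ n hn ih =>
      intro hnT
      rw [← ih (by omega)]
      have hX : AtomConst (M.F n)
          (fun ω' => if sameAtom (M.F t) ω ω' ∧ n < τ ω' then 1 else 0) := by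
        intro ω₁ ω₂ h
        have h' := h.mono (M.F_mono hn)
        have e : sameAtom (M.F t) ω ω₁ ↔ sameAtom (M.F t) ω ω₂ :=
          ⟨fun h'' => h''.trans h', fun h'' => h''.trans h'.symm⟩
        simp only [e, hτ.sameAtom_lt h]
      have hsum := sum_mul_condExp hP0 hX (S (n + 1))
      simp only [hmart n (by omega) _ (hP _)] at hsum
      have hd : ∀ ω', (if sameAtom (M.F t) ω ω' then
          P ω' * (if t < τ ω' then S (min (τ ω') (n + 1)) ω' else 0) else 0) =
          (if sameAtom (M.F t) ω ω' then
          P ω' * (if t < τ ω' then S (min (τ ω') n) ω' else 0) else 0) +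
          (P ω' * ((if sameAtom (M.F t) ω ω' ∧ n < τ ω' then 1 else 0) * S (n + 1) ω') -
          P ω' * ((if sameAtom (M.F t) ω ω' ∧ n < τ ω' then 1 else 0) * S n ω')) := by
        intro ω'
        by_cases h1 : sameAtom (M.F t) ω ω'
        · by_cases h2 : n < τ ω'
          · have h3 : t < τ ω' := by omega
            rw [min_eq_right h2, min_eq_right h2.le]
            simp only [h1, h2, h3, if_true, and_self]
            ring
          · rw [min_eq_left (by omega), min_eq_left (by omega)]
            simp [h1, h2]
        · simp [h1]
      rw [Finset.sum_congr rfl fun ω' _ => hd ω', Finset.sum_add_distrib,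
        Finset.sum_sub_distrib, hsum]
      ring
  have hD : 0 < ∑ ω', if sameAtom (M.F t) ω ω' then P ω' else 0 :=
    hω.trans_le (le_atomProb hP0 ω)
  have hce : condExp (M.F t) P (starVal M (pureChi τ) S (t + 1)) ω =
      chiStar M (pureChi τ) (t + 1) ω * S t ω := by
    rw [condExp_eq, div_eq_iff hD.ne', chiStar_pureChi hτ, Finset.mul_sum]
    simp only [starVal_pureChi hτ]
    have := hconst_stopped M.T ht le_rfl
    simp only [min_eq_left (hτ.1 _)] at this
    rw [this]
    refine Finset.sum_congr rfl fun ω' _ => ?_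
    split_ifs with h1 h2 h3 h3
    · rw [measurable_iff_atomConst.mp (hS t ht) ω ω' h1]
      ring
    · exact absurd ((hτ.sameAtom_lt h1).mpr h2) h3
    · exact absurd ((hτ.sameAtom_lt h1).mp h3) h2
    · ring
    · ring
    · ring
  rw [hce]
  have h01 : 0 ≤ chiStar M (pureChi τ) (t + 1) ω := by
    rw [chiStar_pureChi hτ]
    split_ifs <;> norm_num
  exact ⟨mul_le_mul_of_nonneg_left (hbd t ω ht).1 h01,
    mul_le_mul_of_nonneg_left (hbd t ω ht).2 h01⟩

end Market

section Duality

variable {M}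

lemma SelfFinancing.const (c : ℝ) : SelfFinancing M (fun _ _ => c) (fun _ _ => 0) := by
  refine ⟨measurable_const, measurable_const,
    fun t _ => ⟨measurable_const, measurable_const⟩, fun t _ ω => ?_⟩
  simp [liq]

/-- Starting from nothing, buy `k` shares at time `t` on the atom of `ω` at price `c`, whenever
this is admissible. -/
lemma selfFinancing_buy {t : ℕ} {ω : Ω} {k c : ℝ}
    (hb : k * M.Sb t ω ≤ k * c) (ha : k * M.Sa t ω ≤ k * c) (htT : t ≤ M.T)
    (D : ℕ → Ω → ℝ) (hD : ∀ s ω', t < s → sameAtom (M.F t) ω ω' → D s ω' = 1)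
    (hD0 : ∀ s ω', ¬ (t < s ∧ sameAtom (M.F t) ω ω') → D s ω' = 0) :
    SelfFinancing M (fun s ω' => -(k * c) * D s ω') (fun s ω' => k * D s ω') := by
  have hDm : ∀ s, AtomConst (M.F s) (D (s + 1)) := by
    intro s ω₁ ω₂ h
    by_cases hts : t < s + 1
    · have h' := h.mono (M.F_mono (show t ≤ s by omega))
      by_cases h1 : sameAtom (M.F t) ω ω₁
      · rw [hD _ _ hts h1, hD _ _ hts (h1.trans h')]
      · rw [hD0 _ _ (fun h2 => h1 h2.2), hD0 _ _ (fun h2 => h1 (h2.2.trans h'.symm))]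
    · rw [hD0 _ _ (fun h2 => hts h2.1), hD0 _ _ (fun h2 => hts h2.1)]
  have hz : D 0 = fun _ => 0 := funext fun ω' => hD0 0 ω' (fun h => absurd h.1 (by omega))
  refine ⟨?_, ?_, fun s _ => ⟨?_, ?_⟩, fun s _ ω' => ?_⟩ <;> dsimp only
  · simp only [hz]
    exact measurable_const
  · simp only [hz]
    exact measurable_const
  · exact (measurable_iff_atomConst.mpr (hDm s)).const_mul _
  · exact (measurable_iff_atomConst.mpr (hDm s)).const_mul _
  · by_cases h1 : sameAtom (M.F t) ω ω'
    · rcases lt_trichotomy t s with h | rfl | h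
      · rw [hD s ω' h h1, hD (s + 1) ω' (by omega) h1]
        simp [liq]
      · rw [hD0 t ω' (fun h => absurd h.1 (by omega)), hD (t + 1) ω' (by omega) h1]
        rw [measurable_iff_atomConst.mp (M.Sb_adapted t htT) ω ω' h1] at hb
        rw [measurable_iff_atomConst.mp (M.Sa_adapted t htT) ω ω' h1] at ha
        apply liq_nonneg <;> linarith
      · rw [hD0 s ω' (fun h' => absurd h'.1 (by omega)),
          hD0 (s + 1) ω' (fun h' => absurd h'.1 (by omega))]
        simp [liq]
    · rw [hD0 s ω' (fun h' => h1 h'.2), hD0 (s + 1) ω' (fun h' => h1 h'.2)]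
      simp [liq]

/-- A linear pricing rule for stopped positions, given by a weight `P` and a stock value `R`
carried by atom representatives and consistent with all self-financing strategies, comes from an
element of the dual set. -/
theorem exists_memBarP_of_pricing {τ : Ω → ℕ} (hτ : IsStop M τ) {ξ ζ : ℕ → Ω → ℝ} {P R : Ω → ℝ}
    {y : ℝ} (ω₀ : Ω) (hP : ∀ ω, 0 ≤ P ω)
    (hrep : ∀ ω, P ω ≠ 0 → rep (M.F (τ ω)) ω = ω)
    (hRb : ∀ ω, P ω * M.Sb (τ ω) ω ≤ R ω) (hRa : ∀ ω, R ω ≤ P ω * M.Sa (τ ω) ω)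
    (H : ∀ (α β : ℕ → Ω → ℝ) (h : ℝ), SelfFinancing M α β → (∀ ω, β 0 ω = 0) →
      ∑ ω, (P ω * (α (τ ω) ω + h * ξ (τ ω) ω) + R ω * (β (τ ω) ω + h * ζ (τ ω) ω)) ≤
        α 0 ω₀ + y * h) :
    ∃ P S, memBarP M (pureChi τ) P S ∧
      expect P (fun ω => ξ (τ ω) ω + S (τ ω) ω * ζ (τ ω) ω) = y := by
  classical
  set S : ℕ → Ω → ℝ := fun t ω =>
    if τ (rep (M.F t) ω) = t ∧ 0 < P (rep (M.F t) ω) then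
      R (rep (M.F t) ω) / P (rep (M.F t) ω) else M.Sb t ω with hSdef
  have hPS : ∀ ω, P ω * S (τ ω) ω = R ω := by
    intro ω
    rcases (hP ω).eq_or_lt with h | h
    · have h1 := hRb ω
      have h2 := hRa ω
      rw [← h, zero_mul] at h1 h2
      rw [← h, zero_mul]
      linarith
    · have : S (τ ω) ω = R ω / P ω := by
        simp only [hSdef, hrep ω h.ne']
        simp [h]
      rw [this]
      field_simp
  have hP1 : ∑ ω, P ω = 1 := by
    have h1 := H _ _ 0 (SelfFinancing.const 1) (fun _ => rfl)
    have h2 := H _ _ 0 (SelfFinancing.const (-1)) (fun _ => rfl)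
    simp only [zero_mul, add_zero, mul_zero, mul_one, mul_neg, Finset.sum_neg_distrib] at h1 h2
    linarith
  have hy : expect P (fun ω => ξ (τ ω) ω + S (τ ω) ω * ζ (τ ω) ω) = y := by
    have h1 := H _ _ 1 (SelfFinancing.const 0) (fun _ => rfl)
    have h2 := H _ _ (-1) (SelfFinancing.const 0) (fun _ => rfl)
    have e : expect P (fun ω => ξ (τ ω) ω + S (τ ω) ω * ζ (τ ω) ω) =
        ∑ ω, (P ω * ξ (τ ω) ω + R ω * ζ (τ ω) ω) :=
      Finset.sum_congr rfl fun ω _ => by rw [← hPS ω]; ring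
    simp only [zero_add, one_mul, neg_mul, mul_one, mul_neg, ← neg_add,
      Finset.sum_neg_distrib] at h1 h2
    rw [e]
    linarith
  refine ⟨P, S, ⟨hP, hP1, fun t ht => ?_, fun t ω ht => ?_, fun t ht ω hω => ?_⟩, hy⟩
  · refine measurable_iff_atomConst.mpr fun ω ω' h => ?_
    simp only [hSdef, rep_eq_of_sameAtom h,
      measurable_iff_atomConst.mp (M.Sb_adapted t ht) ω ω' h]
  · simp only [hSdef]
    split_ifs with hc
    · have hr := sameAtom_rep (M.F t) ω
      rw [← measurable_iff_atomConst.mp (M.Sb_adapted t ht) _ _ hr,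
        ← measurable_iff_atomConst.mp (M.Sa_adapted t ht) _ _ hr, le_div_iff₀ hc.2,
        div_le_iff₀ hc.2]
      have h1 := hRb (rep (M.F t) ω)
      have h2 := hRa (rep (M.F t) ω)
      rw [hc.1] at h1 h2
      constructor <;> linarith
    · exact ⟨le_rfl, M.Sb_le_Sa t ω ht⟩
  · have hD : 0 < ∑ ω', if sameAtom (M.F t) ω ω' then P ω' else 0 :=
      hω.trans_le (le_atomProb hP ω)
    rw [chiStar_pureChi hτ, condExp_eq, div_le_iff₀ hD, le_div_iff₀ hD]
    simp only [starVal_pureChi hτ]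
    by_cases hlt : t < τ ω
    · have hlt' : ∀ ω', sameAtom (M.F t) ω ω' → t < τ ω' := fun ω' h =>
        (hτ.sameAtom_lt h).mp hlt
      have key : ∀ k c : ℝ, k * M.Sb t ω ≤ k * c → k * M.Sa t ω ≤ k * c →
          k * ∑ ω', (if sameAtom (M.F t) ω ω' then R ω' else 0) ≤
            k * c * ∑ ω', (if sameAtom (M.F t) ω ω' then P ω' else 0) := by
        intro k c hb ha
        have h1 := H _ _ 0 (selfFinancing_buy hb ha ht
          (fun s ω' => if t < s ∧ sameAtom (M.F t) ω ω' then 1 else 0)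
          (fun s ω' h h' => if_pos ⟨h, h'⟩) (fun s ω' h => if_neg h))
          (fun ω' => by simp)
        simp only [zero_mul, add_zero, mul_zero, not_lt_zero, false_and, if_false] at h1
        rw [Finset.mul_sum, Finset.mul_sum, ← sub_nonpos, ← Finset.sum_sub_distrib]
        refine le_trans (le_of_eq (Finset.sum_congr rfl fun ω' _ => ?_)) h1
        by_cases h : sameAtom (M.F t) ω ω'
        · simp only [h, hlt' ω' h, and_self, if_true]
          ring
        · simp [h]
      have e : ∑ ω', (if sameAtom (M.F t) ω ω' then
          P ω' * (if t < τ ω' then S (τ ω') ω' else 0) else 0) =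
          ∑ ω', (if sameAtom (M.F t) ω ω' then R ω' else 0) :=
        Finset.sum_congr rfl fun ω' _ => by
          split_ifs with h1 h2
          · exact hPS ω'
          · exact absurd (hlt' ω' h1) h2
          · rfl
      rw [e, if_pos hlt, one_mul, one_mul]
      have hba := M.Sb_le_Sa t ω ht
      have k1 := key 1 (M.Sa t ω) (by linarith) (by linarith)
      have k2 := key (-1) (M.Sb t ω) (by linarith) (by linarith)
      constructor <;> linarith
    · have e : ∑ ω', (if sameAtom (M.F t) ω ω' then
          P ω' * (if t < τ ω' then S (τ ω') ω' else 0) else 0) = 0 :=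
        Finset.sum_eq_zero fun ω' _ => by
          split_ifs with h1 h2
          · exact absurd ((hτ.sameAtom_lt h1).mpr h2) hlt
          · exact mul_zero _
          · rfl
      rw [e, if_neg hlt]
      simp

/-- The position process generated by unconstrained holdings `a`: predictable by construction,
with initial value scaled by `c`. -/
def position (M : Market Ω) (c : ℝ) (ω₀ : Ω) (a : ℕ → Ω → ℝ) : ℕ → Ω → ℝ
  | 0, _ => c * a 0 ω₀
  | t + 1, ω => a (t + 1) (rep (M.F t) ω)

lemma position_add (c : ℝ) (ω₀ : Ω) (a a' : ℕ → Ω → ℝ) (t : ℕ) (ω : Ω) :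
    position M c ω₀ (a + a') t ω = position M c ω₀ a t ω + position M c ω₀ a' t ω := by
  cases t <;> simp [position, mul_add]

lemma position_smul (c : ℝ) (ω₀ : Ω) (r : ℝ) (a : ℕ → Ω → ℝ) (t : ℕ) (ω : Ω) :
    position M c ω₀ (r • a) t ω = r * position M c ω₀ a t ω := by
  cases t <;> simp [position, mul_left_comm]

lemma measurable_position_zero (c : ℝ) (ω₀ : Ω) (a : ℕ → Ω → ℝ) :
    Measurable[M.F 0] (position M c ω₀ a 0) :=
  measurable_iff_atomConst.mpr fun _ _ _ => rfl

lemma measurable_position_succ (c : ℝ) (ω₀ : Ω) (a : ℕ → Ω → ℝ) (t : ℕ) :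
    Measurable[M.F t] (position M c ω₀ a (t + 1)) :=
  measurable_iff_atomConst.mpr fun ω ω' h => by simp only [position, rep_eq_of_sameAtom h]

lemma position_of_predictable {c : ℝ} {ω₀ : Ω} {a : ℕ → Ω → ℝ} (h0 : ∀ ω, a 0 ω = c * a 0 ω₀)
    (h : ∀ t, t < M.T → Measurable[M.F t] (a (t + 1))) {t : ℕ} (ht : t ≤ M.T) (ω : Ω) :
    position M c ω₀ a t ω = a t ω := by
  cases t with
  | zero => exact (h0 ω).symm
  | succ t => exact measurable_iff_atomConst.mp (h t ht) _ _ (sameAtom_rep _ _)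

/-- The ask price for `true`, the bid price for `false`. -/
def bidAsk (M : Market Ω) (s : Bool) (t : ℕ) (ω : Ω) : ℝ := if s then M.Sa t ω else M.Sb t ω

/-- Cash holdings, stock holdings, and a multiple of the option payoff. -/
abbrev Holdings (Ω : Type*) : Type _ := (ℕ → Ω → ℝ) × (ℕ → Ω → ℝ) × ℝ

/-- The self-financing constraint at time `t` in scenario `ω`. -/
def tradeConstraint (M : Market Ω) (ω₀ : Ω) (t : ℕ) (ω : Ω) (s : Bool) : Holdings Ω →ₗ[ℝ] ℝ where
  toFun w := (position M 1 ω₀ w.1 t ω - position M 1 ω₀ w.1 (t + 1) ω) +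
    bidAsk M s t ω * (position M 0 ω₀ w.2.1 t ω - position M 0 ω₀ w.2.1 (t + 1) ω)
  map_add' w w' := by
    simp only [Prod.fst_add, Prod.snd_add, position_add]
    ring
  map_smul' r w := by
    simp only [Prod.smul_fst, Prod.smul_snd, position_smul, RingHom.id_apply, smul_eq_mul]
    ring

/-- The exercise constraint in scenario `ω`, imposed on atom representatives only. -/
def exerciseConstraint (M : Market Ω) (ξ ζ : ℕ → Ω → ℝ) (τ : Ω → ℕ) (ω₀ ω : Ω) (s : Bool) :
    Holdings Ω →ₗ[ℝ] ℝ where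
  toFun w := Set.indicator {ω' | rep (M.F (τ ω')) ω' = ω'} 1 ω *
    ((position M 1 ω₀ w.1 (τ ω) ω + w.2.2 * ξ (τ ω) ω) +
    bidAsk M s (τ ω) ω * (position M 0 ω₀ w.2.1 (τ ω) ω + w.2.2 * ζ (τ ω) ω))
  map_add' w w' := by
    simp only [Prod.fst_add, Prod.snd_add, position_add]
    ring
  map_smul' r w := by
    simp only [Prod.smul_fst, Prod.smul_snd, position_smul, RingHom.id_apply, smul_eq_mul]
    ring

/-- All constraints on a hedge exercised at `τ`. -/
def hedgeConstraint (M : Market Ω) (ξ ζ : ℕ → Ω → ℝ) (τ : Ω → ℕ) (ω₀ : Ω) :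
    (Fin M.T × Ω × Bool) ⊕ (Ω × Bool) → Holdings Ω →ₗ[ℝ] ℝ
  | Sum.inl i => tradeConstraint M ω₀ i.1 i.2.1 i.2.2
  | Sum.inr i => exerciseConstraint M ξ ζ τ ω₀ i.1 i.2

/-- The initial cash holding. -/
def initialCash (ω₀ : Ω) : Holdings Ω →ₗ[ℝ] ℝ where
  toFun w := w.1 0 ω₀
  map_add' _ _ := rfl
  map_smul' _ _ := rfl

/-- The multiple of the option payoff. -/
def payoffScale : Holdings Ω →ₗ[ℝ] ℝ := (LinearMap.snd ℝ _ _).comp (LinearMap.snd ℝ _ _)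

/-- Holdings that satisfy all constraints give a hedge. -/
lemma hedge_of_constraints {ξ ζ : ℕ → Ω → ℝ} (hpay : AdaptedPair M ξ ζ) {τ : Ω → ℕ}
    (hτ : IsStop M τ) {ω₀ : Ω} {w : Holdings Ω} (hw : ∀ i, 0 ≤ hedgeConstraint M ξ ζ τ ω₀ i w) :
    SelfFinancing M (position M 1 ω₀ w.1) (position M 0 ω₀ w.2.1) ∧
      ∀ ω, 0 ≤ liq M (τ ω) ω (position M 1 ω₀ w.1 (τ ω) ω + w.2.2 * ξ (τ ω) ω)
        (position M 0 ω₀ w.2.1 (τ ω) ω + w.2.2 * ζ (τ ω) ω) := by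
  have hsf : SelfFinancing M (position M 1 ω₀ w.1) (position M 0 ω₀ w.2.1) :=
    ⟨measurable_position_zero _ _ _, measurable_position_zero _ _ _,
      fun t _ => ⟨measurable_position_succ _ _ _ t, measurable_position_succ _ _ _ t⟩,
      fun t ht ω => liq_nonneg (hw (Sum.inl (⟨t, ht⟩, ω, false)))
        (hw (Sum.inl (⟨t, ht⟩, ω, true)))⟩
  refine ⟨hsf, fun ω => ?_⟩
  obtain ⟨t, ht⟩ : ∃ t, t = τ ω := ⟨_, rfl⟩
  have htT : t ≤ M.T := ht ▸ hτ.1 ω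
  have hr := sameAtom_rep (M.F t) ω
  have hτr : τ (rep (M.F t) ω) = t := hτ.sameAtom_eq hr.symm ht.symm
  have hmem : rep (M.F (τ (rep (M.F t) ω))) (rep (M.F t) ω) = rep (M.F t) ω := by
    rw [hτr]
    exact rep_eq_of_sameAtom hr
  have hpos : ∀ (c : ℝ) (a : ℕ → Ω → ℝ),
      position M c ω₀ a t (rep (M.F t) ω) = position M c ω₀ a t ω := by
    intro c a
    refine AtomConst.mono (m := M.F (t - 1)) (M.F_mono (Nat.sub_le t 1)) ?_ _ _ hr
    rcases t with _ | t
    · exact measurable_iff_atomConst.mp (measurable_position_zero _ _ _)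
    · exact measurable_iff_atomConst.mp (measurable_position_succ _ _ _ _)
  have key : ∀ s, 0 ≤ (position M 1 ω₀ w.1 t ω + w.2.2 * ξ t ω) +
      bidAsk M s t ω * (position M 0 ω₀ w.2.1 t ω + w.2.2 * ζ t ω) := by
    intro s
    have h : (0 : ℝ) ≤ Set.indicator {ω' | rep (M.F (τ ω')) ω' = ω'} 1 (rep (M.F t) ω) * _ :=
      hw (Sum.inr (rep (M.F t) ω, s))
    rw [Set.indicator_of_mem (by exact hmem), Pi.one_apply, one_mul, hτr, hpos, hpos,
      measurable_iff_atomConst.mp (hpay.1 t htT) _ _ hr,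
      measurable_iff_atomConst.mp (hpay.2 t htT) _ _ hr] at h
    have hq : bidAsk M s t (rep (M.F t) ω) = bidAsk M s t ω := by
      simp only [bidAsk, measurable_iff_atomConst.mp (M.Sa_adapted t htT) _ _ hr,
        measurable_iff_atomConst.mp (M.Sb_adapted t htT) _ _ hr]
    rwa [hq] at h
  rw [← ht]
  exact liq_nonneg (key false) (key true)

lemma liq_initial (ω₀ ω : Ω) (w : Holdings Ω) :
    liq M 0 ω (-position M 1 ω₀ w.1 0 ω) (-position M 0 ω₀ w.2.1 0 ω) = -initialCash ω₀ w := by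
  simp [liq, position, initialCash]

/-- Nonnegative multipliers of the constraints give an element of the dual set. -/
lemma exists_memBarP_of_multipliers {τ : Ω → ℕ} (hτ : IsStop M τ) {ξ ζ : ℕ → Ω → ℝ} {ω₀ : Ω}
    {y : ℝ} {u : (Fin M.T × Ω × Bool) ⊕ (Ω × Bool) → ℝ} (hu : ∀ i, 0 ≤ u i)
    (h : ∀ w, initialCash ω₀ w + y * payoffScale w =
      ∑ i, u i * hedgeConstraint M ξ ζ τ ω₀ i w) :
    ∃ P S, memBarP M (pureChi τ) P S ∧
      expect P (fun ω => ξ (τ ω) ω + S (τ ω) ω * ζ (τ ω) ω) = y := by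
  set I : Ω → ℝ := Set.indicator {ω' | rep (M.F (τ ω')) ω' = ω'} 1
  have hI0 : ∀ ω, 0 ≤ I ω := fun ω => Set.indicator_nonneg (fun _ _ => zero_le_one) ω
  have hu0 : ∀ ω s, 0 ≤ I ω * u (Sum.inr (ω, s)) := fun ω s => mul_nonneg (hI0 ω) (hu _)
  refine exists_memBarP_of_pricing hτ ω₀
    (P := fun ω => I ω * u (Sum.inr (ω, true)) + I ω * u (Sum.inr (ω, false)))
    (R := fun ω => I ω * u (Sum.inr (ω, true)) * M.Sa (τ ω) ω +
      I ω * u (Sum.inr (ω, false)) * M.Sb (τ ω) ω)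
    (fun ω => add_nonneg (hu0 ω _) (hu0 ω _)) (fun ω hω => ?_) (fun ω => ?_) (fun ω => ?_) ?_
  · by_contra hc
    refine hω ?_
    have : I ω = 0 := Set.indicator_of_notMem hc _
    simp [this]
  · have := mul_le_mul_of_nonneg_left (M.Sb_le_Sa (τ ω) ω (hτ.1 ω)) (hu0 ω true)
    linarith
  · have := mul_le_mul_of_nonneg_left (M.Sb_le_Sa (τ ω) ω (hτ.1 ω)) (hu0 ω false)
    linarith
  · intro α β k hsf hβ
    have hα0 : ∀ ω, α 0 ω = 1 * α 0 ω₀ := fun ω => by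
      rw [one_mul]
      exact measurable_iff_atomConst.mp hsf.1 _ _ (by rw [M.F_zero]; exact sameAtom_bot _ _)
    have hβ0 : ∀ ω, β 0 ω = 0 * β 0 ω₀ := fun ω => by rw [zero_mul, hβ]
    have hpα : ∀ {t}, t ≤ M.T → ∀ ω, position M 1 ω₀ α t ω = α t ω :=
      position_of_predictable hα0 fun t ht => (hsf.2.2.1 t ht).1
    have hpβ : ∀ {t}, t ≤ M.T → ∀ ω, position M 0 ω₀ β t ω = β t ω :=
      position_of_predictable hβ0 fun t ht => (hsf.2.2.1 t ht).2
    have h1 : α 0 ω₀ + y * k = _ := h (α, β, k)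
    rw [h1, Fintype.sum_sum_type]
    have htrade : 0 ≤ ∑ i : Fin M.T × Ω × Bool,
        u (Sum.inl i) * hedgeConstraint M ξ ζ τ ω₀ (Sum.inl i) (α, β, k) := by
      refine Finset.sum_nonneg fun i _ => mul_nonneg (hu _) ?_
      obtain ⟨t, ω, s⟩ := i
      have hs := hsf.2.2.2 t t.2 ω
      have hba := M.Sb_le_Sa t ω t.2.le
      change 0 ≤ (position M 1 ω₀ α t ω - position M 1 ω₀ α (t + 1) ω) +
        bidAsk M s t ω * (position M 0 ω₀ β t ω - position M 0 ω₀ β (t + 1) ω)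
      rw [hpα t.2.le, hpα t.2, hpβ t.2.le, hpβ t.2]
      refine hs.trans (liq_le ?_ ?_ _ _) <;> cases s <;> simp [bidAsk, hba]
    have hex : ∑ i : Ω × Bool,
        u (Sum.inr i) * hedgeConstraint M ξ ζ τ ω₀ (Sum.inr i) (α, β, k) =
        ∑ ω, ((I ω * u (Sum.inr (ω, true)) + I ω * u (Sum.inr (ω, false))) *
            (α (τ ω) ω + k * ξ (τ ω) ω) +
          (I ω * u (Sum.inr (ω, true)) * M.Sa (τ ω) ω +
            I ω * u (Sum.inr (ω, false)) * M.Sb (τ ω) ω) * (β (τ ω) ω + k * ζ (τ ω) ω)) := by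
      rw [Fintype.sum_prod_type]
      refine Finset.sum_congr rfl fun ω _ => ?_
      rw [Fintype.sum_bool]
      change u (Sum.inr (ω, true)) * (I ω *
        ((position M 1 ω₀ α (τ ω) ω + k * ξ (τ ω) ω) +
          bidAsk M true (τ ω) ω * (position M 0 ω₀ β (τ ω) ω + k * ζ (τ ω) ω))) +
        u (Sum.inr (ω, false)) * (I ω *
        ((position M 1 ω₀ α (τ ω) ω + k * ξ (τ ω) ω) +
          bidAsk M false (τ ω) ω * (position M 0 ω₀ β (τ ω) ω + k * ζ (τ ω) ω))) = _
      rw [hpα (hτ.1 ω), hpβ (hτ.1 ω)]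
      simp only [bidAsk, if_true, Bool.false_eq_true, if_false]
      ring
    linarith

/-- Some deterministic amount of cash covers the exercise at `τ`. -/
lemma exists_constraints_nonneg (ξ ζ : ℕ → Ω → ℝ) (τ : Ω → ℕ) (ω₀ : Ω) :
    ∃ w, (∀ i, 0 ≤ hedgeConstraint M ξ ζ τ ω₀ i w) ∧ payoffScale w = 1 := by
  obtain ⟨C, hC⟩ := Finite.bddAbove_range fun i : Ω × Bool =>
    -(ξ (τ i.1) i.1 + bidAsk M i.2 (τ i.1) i.1 * ζ (τ i.1) i.1)
  have hpC : ∀ t ω, position M 1 ω₀ (fun _ _ => C) t ω = C := by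
    intro t ω
    cases t <;> simp [position]
  have hp0 : ∀ t ω, position M 0 ω₀ (fun _ _ => 0) t ω = 0 := by
    intro t ω
    cases t <;> simp [position]
  refine ⟨(fun _ _ => C, fun _ _ => 0, 1), fun i => ?_, rfl⟩
  rcases i with ⟨t, ω, s⟩ | ⟨ω, s⟩
  · change 0 ≤ (position M 1 ω₀ (fun _ _ => C) t ω - position M 1 ω₀ (fun _ _ => C) (t + 1) ω) +
        bidAsk M s t ω * (position M 0 ω₀ (fun _ _ => 0) t ω -
          position M 0 ω₀ (fun _ _ => 0) (t + 1) ω)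
    simp only [hpC, hp0]
    simp
  · refine mul_nonneg (Set.indicator_nonneg (fun _ _ => zero_le_one) ω) ?_
    change 0 ≤ (position M 1 ω₀ (fun _ _ => C) (τ ω) ω + 1 * ξ (τ ω) ω) +
      bidAsk M s (τ ω) ω * (position M 0 ω₀ (fun _ _ => 0) (τ ω) ω + 1 * ζ (τ ω) ω)
    rw [hpC, hp0]
    have : -(ξ (τ ω) ω + bidAsk M s (τ ω) ω * ζ (τ ω) ω) ≤ C := hC ⟨(ω, s), rfl⟩
    linarith

/-- Absence of a hedge raising `x` produces a dual value below `x`. -/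
lemma exists_hedge_or_dual_lt {ξ ζ : ℕ → Ω → ℝ} {τ : Ω → ℕ} (hτ : IsStop M τ) (ω₀ : Ω) (x : ℝ) :
    (∃ w, (∀ i, 0 ≤ hedgeConstraint M ξ ζ τ ω₀ i w) ∧ payoffScale w = 1 ∧
        x ≤ -initialCash ω₀ w) ∨
      ∃ P S, memBarP M (pureChi τ) P S ∧
        expect P (fun ω => ξ (τ ω) ω + S (τ ω) ω * ζ (τ ω) ω) < x := by
  by_cases hc : ∃ w, (∀ i, 0 ≤ hedgeConstraint M ξ ζ τ ω₀ i w) ∧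
      0 ≤ (-initialCash ω₀ - x • payoffScale : Holdings Ω →ₗ[ℝ] ℝ) w ∧ 0 < payoffScale w
  · left
    obtain ⟨w, hw, hx, hpos⟩ := hc
    refine ⟨(payoffScale w)⁻¹ • w, fun i => ?_, ?_, ?_⟩
    · rw [map_smul]
      exact mul_nonneg (inv_nonneg.mpr hpos.le) (hw i)
    · rw [map_smul, smul_eq_mul, inv_mul_cancel₀ hpos.ne']
    · simp only [LinearMap.sub_apply, LinearMap.neg_apply, LinearMap.smul_apply,
        smul_eq_mul] at hx
      rw [map_smul, smul_eq_mul, ← mul_neg, inv_mul_eq_div, le_div_iff₀ hpos]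
      linarith
  · right
    push Not at hc
    obtain ⟨u, κ, hu, hκ, hid⟩ := farkas_with_extra (hedgeConstraint M ξ ζ τ ω₀)
      (-initialCash ω₀ - x • payoffScale) (-payoffScale) (fun w hw hx => by
        have := hc w hw hx
        simpa using this)
    simp only [LinearMap.sub_apply, LinearMap.neg_apply, LinearMap.smul_apply,
      smul_eq_mul] at hid
    have hκ' : 0 < κ := by
      refine hκ.lt_of_ne fun h0 => ?_
      obtain ⟨w, hw, hw1⟩ := exists_constraints_nonneg (M := M) ξ ζ τ ω₀
      have h1 := hid w
      rw [← h0, hw1, zero_mul, zero_add] at h1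
      have h2 : 0 ≤ ∑ i, u i * hedgeConstraint M ξ ζ τ ω₀ i w :=
        Finset.sum_nonneg fun i _ => mul_nonneg (hu i) (hw i)
      linarith
    obtain ⟨P, S, hPS, hval⟩ := exists_memBarP_of_multipliers (y := x - κ⁻¹) hτ
      (u := fun i => κ⁻¹ * u i) (fun i => mul_nonneg (inv_nonneg.mpr hκ) (hu i)) (fun w => by
        simp only [mul_assoc]
        rw [← Finset.mul_sum, ← sub_eq_iff_eq_add'.mpr (hid w)]
        field_simp
        ring)
    refine ⟨P, S, hPS, ?_⟩
    rw [hval]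
    have := inv_pos.mpr hκ'
    linarith

/-- Strong duality for hedges exercised at a fixed pure stopping time, with both extrema
attained. -/
theorem exists_optimal_hedge_and_dual {ξ ζ : ℕ → Ω → ℝ} (hpay : AdaptedPair M ξ ζ)
    (hNA : ArbitrageFree M) {τ : Ω → ℕ} (hτ : IsStop M τ) (ω₀ : Ω) :
    ∃ α β P S, SelfFinancing M α β ∧
      (∀ ω, 0 ≤ liq M (τ ω) ω (α (τ ω) ω + ξ (τ ω) ω) (β (τ ω) ω + ζ (τ ω) ω)) ∧
      memBarP M (pureChi τ) P S ∧
      ∀ ω, liq M 0 ω (-α 0 ω) (-β 0 ω) =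
        expect P (fun ω => ξ (τ ω) ω + S (τ ω) ω * ζ (τ ω) ω) := by
  set V : Set ℝ := {v | ∃ P S, memBarP M (pureChi τ) P S ∧
    expect P (fun ω => ξ (τ ω) ω + S (τ ω) ω * ζ (τ ω) ω) = v}
  have hweak : ∀ w, (∀ i, 0 ≤ hedgeConstraint M ξ ζ τ ω₀ i w) → ∀ v ∈ V,
      -initialCash ω₀ w ≤ payoffScale w * v := by
    rintro w hw _ ⟨P, S, hPS, rfl⟩
    obtain ⟨h1, h2⟩ := hedge_of_constraints hpay hτ hw
    have := liq_le_expect hτ hPS (ξ := fun t ω => w.2.2 * ξ t ω)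
      (ζ := fun t ω => w.2.2 * ζ t ω) h1 h2 ω₀
    rw [liq_initial] at this
    refine this.trans (le_of_eq ?_)
    change _ = w.2.2 * _
    unfold expect
    rw [Finset.mul_sum]
    exact Finset.sum_congr rfl fun ω _ => by ring
  have hne : V.Nonempty := by
    obtain ⟨P, S, hPS⟩ := exists_memBarP hNA hτ
    exact ⟨_, P, S, hPS, rfl⟩
  have hbdd : BddBelow V := by
    obtain ⟨w, hw, hw1⟩ := exists_constraints_nonneg (M := M) ξ ζ τ ω₀
    refine ⟨-initialCash ω₀ w, fun v hv => ?_⟩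
    have := hweak w hw v hv
    rwa [hw1, one_mul] at this
  obtain ⟨w, hw, hw1, hwx⟩ : ∃ w, (∀ i, 0 ≤ hedgeConstraint M ξ ζ τ ω₀ i w) ∧
      payoffScale w = 1 ∧ sInf V ≤ -initialCash ω₀ w := by
    rcases exists_hedge_or_dual_lt (M := M) (ξ := ξ) (ζ := ζ) hτ ω₀ (sInf V) with
      h | ⟨P, S, hPS, hlt⟩
    · exact h
    · exact absurd (csInf_le hbdd ⟨P, S, hPS, rfl⟩) (not_le.mpr hlt)
  obtain ⟨u, κ, hu, hκ, hid⟩ := farkas_with_extra (hedgeConstraint M ξ ζ τ ω₀) payoffScale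
    (initialCash ω₀ + sInf V • payoffScale) (fun w' hw' hk => by
      simp only [LinearMap.add_apply, LinearMap.smul_apply, smul_eq_mul]
      rcases hk.eq_or_lt with h0 | h0
      · obtain ⟨v, hv⟩ := hne
        have := hweak w' hw' v hv
        rw [← h0] at this ⊢
        linarith
      · have : -initialCash ω₀ w' / payoffScale w' ≤ sInf V := by
          refine le_csInf hne fun v hv => ?_
          rw [div_le_iff₀ h0, mul_comm]
          exact hweak w' hw' v hv
        rw [div_le_iff₀ h0] at this
        linarith)
  simp only [LinearMap.add_apply, LinearMap.smul_apply, smul_eq_mul] at hid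
  obtain ⟨P, S, hPS, hval⟩ := exists_memBarP_of_multipliers (y := sInf V - κ) hτ hu
    (fun w' => by linarith [hid w'])
  obtain ⟨h1, h2⟩ := hedge_of_constraints hpay hτ hw
  have hs : w.2.2 = 1 := hw1
  simp only [hs, one_mul] at h2
  refine ⟨_, _, P, S, h1, h2, hPS, fun ω => ?_⟩
  rw [liq_initial]
  refine le_antisymm ?_ (by linarith)
  have := hweak w hw _ ⟨P, S, hPS, rfl⟩
  rwa [hw1, one_mul] at this

lemma finite_isStop : {τ : Ω → ℕ | IsStop M τ}.Finite :=
  (Set.Finite.pi' (fun _ : Ω => Set.finite_Iic M.T)).subset fun _ hτ ω => hτ.1 ω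

lemma isStop_zero : IsStop M (fun _ => 0) :=
  ⟨fun _ => Nat.zero_le _, fun _ => MeasurableSet.const _⟩

end Duality

/-- Theorem (buyer's price representation): the supremum defining the bid price is
attained, and π^b = max over pure stopping times τ of the minimum over
(P,S) ∈ barP(τ) of E_P(ξ_τ + S_τ ζ_τ), with the minimum attained. -/
theorem buyer_price_representation (ξ ζ : ℕ → Ω → ℝ)
    (hpay : AdaptedPair M ξ ζ) (hNA : ArbitrageFree M) :
    (∃ α β, BuyerHedge M ξ ζ α β ∧
        ∀ ω, liq M 0 ω (-α 0 ω) (-β 0 ω) = bidPrice M ξ ζ) ∧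
    (∃ τ P S, IsStop M τ ∧ memBarP M (pureChi τ) P S ∧
        bidPrice M ξ ζ = expect P (fun ω => ξ (τ ω) ω + S (τ ω) ω * ζ (τ ω) ω) ∧
        ∀ P' S', memBarP M (pureChi τ) P' S' →
          expect P (fun ω => ξ (τ ω) ω + S (τ ω) ω * ζ (τ ω) ω) ≤
            expect P' (fun ω => ξ (τ ω) ω + S' (τ ω) ω * ζ (τ ω) ω)) ∧
    (∀ τ, IsStop M τ → ∃ P S, memBarP M (pureChi τ) P S ∧
        expect P (fun ω => ξ (τ ω) ω + S (τ ω) ω * ζ (τ ω) ω) ≤ bidPrice M ξ ζ ∧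
        ∀ P' S', memBarP M (pureChi τ) P' S' →
          expect P (fun ω => ξ (τ ω) ω + S (τ ω) ω * ζ (τ ω) ω) ≤
            expect P' (fun ω => ξ (τ ω) ω + S' (τ ω) ω * ζ (τ ω) ω)) := by
  classical
  have hΩ : Nonempty Ω := by
    by_contra hc
    rw [not_nonempty_iff] at hc
    have := M.Q_sum
    simp at this
  obtain ⟨ω₀⟩ := hΩ
  choose! α β P S hsf hex hPS hval using fun τ (hτ : IsStop M τ) =>
    exists_optimal_hedge_and_dual hpay hNA hτ ω₀
  set v : (Ω → ℕ) → ℝ := fun τ =>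
    expect (P τ) (fun ω => ξ (τ ω) ω + S τ (τ ω) ω * ζ (τ ω) ω)
  have hmin : ∀ τ, IsStop M τ → ∀ P' S', memBarP M (pureChi τ) P' S' →
      v τ ≤ expect P' (fun ω => ξ (τ ω) ω + S' (τ ω) ω * ζ (τ ω) ω) := fun τ hτ P' S' h => by
    have := liq_le_expect hτ h (hsf τ hτ) (hex τ hτ) ω₀
    rwa [hval τ hτ] at this
  obtain ⟨τ, hτ, hmax⟩ := Set.exists_max_image _ v (finite_isStop (M := M)) ⟨_, isStop_zero⟩
  have hbid : bidPrice M ξ ζ = v τ := by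
    refine IsGreatest.csSup_eq ⟨⟨α τ, β τ, ⟨hsf τ hτ, τ, hτ, hex τ hτ⟩,
      fun ω => (hval τ hτ ω).symm⟩, ?_⟩
    rintro x ⟨α', β', ⟨hsf', τ', hτ', hex'⟩, hx⟩
    rw [hx ω₀]
    exact (liq_le_expect hτ' (hPS τ' hτ') hsf' hex' ω₀).trans (hmax τ' hτ')
  refine ⟨⟨α τ, β τ, ⟨hsf τ hτ, τ, hτ, hex τ hτ⟩, fun ω => ?_⟩,
    ⟨τ, P τ, S τ, hτ, hPS τ hτ, hbid, hmin τ hτ⟩,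
    fun τ' hτ' => ⟨P τ', S τ', hPS τ' hτ', ?_, hmin τ' hτ'⟩⟩
  · rw [hval τ hτ, hbid]
  · rw [hbid]
    exact hmax τ' hτ'

end RZ
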